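/- Let A be a bireversible automaton such that either the alphabet X has exactly two elements or the state set S has exactly two elements. If the automaton group G_A is infinite, then π₁(Δ_A) is not residually finite: there exists γ ∈ π₁(Δ_A) with γ ≠ 1 such that γ belongs to every finite-index normal subgroup of π₁(Δ_A). -/

import Mathlib

/-- A Mealy automaton with state set `S` and alphabet `X`:
`λ(s,x) = (o s x, t s x)`. -/
structure Mealy (S X : Type) where
  o : S → X → X
  t : S → X → S

namespace Mealy

variable {S X : Type}

/-- Bireversibility of a Mealy automaton. -/
def Bireversible (M : Mealy S X) : Prop :=
  (∀ s, Function.Bijective (M.o s)) ∧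
  (∀ x, Function.Bijective (fun s => M.t s x)) ∧
  Function.Bijective (fun p : S × X => (M.o p.1 p.2, M.t p.1 p.2))

/-- The action of a state on words over the alphabet. -/
def actWord (M : Mealy S X) : S → List X → List X
  | _, [] => []
  | s, x :: w => M.o s x :: M.actWord (M.t s x) w

/-- The dual action of a letter on words over the states. -/
def dualActWord (M : Mealy S X) : X → List S → List S
  | _, [] => []
  | x, s :: w => M.t s x :: M.dualActWord (M.o s x) w

/-- The relators `s x (t s x)⁻¹ (o s x)⁻¹` of the square-complex group. -/
def rels (M : Mealy S X) : Set (FreeGroup (S ⊕ X)) :=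
  ⋃ (s : S) (x : X),
    {FreeGroup.of (Sum.inl s) * FreeGroup.of (Sum.inr x) *
      (FreeGroup.of (Sum.inl (M.t s x)))⁻¹ * (FreeGroup.of (Sum.inr (M.o s x)))⁻¹}

/-- The fundamental group `π₁(Δ_A)` of the square complex of the automaton. -/
abbrev Pi1 (M : Mealy S X) := PresentedGroup M.rels

/-- The image of a state in `π₁(Δ_A)`. -/
def genS (M : Mealy S X) (s : S) : M.Pi1 := PresentedGroup.of (Sum.inl s)

/-- The image of a letter in `π₁(Δ_A)`. -/
def genX (M : Mealy S X) (x : X) : M.Pi1 := PresentedGroup.of (Sum.inr x)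

/-- The subgroup `⟨S⟩` of `π₁(Δ_A)`. -/
def subS (M : Mealy S X) : Subgroup M.Pi1 := Subgroup.closure (Set.range M.genS)

/-- The subgroup `⟨X⟩` of `π₁(Δ_A)`. -/
def subX (M : Mealy S X) : Subgroup M.Pi1 := Subgroup.closure (Set.range M.genX)

/-- The automaton group `G_A`: the subgroup of `Perm (List X)` generated by the
permutations `σ_s` defined by the states. -/
def autGroup (M : Mealy S X) : Subgroup (Equiv.Perm (List X)) :=
  Subgroup.closure {σ : Equiv.Perm (List X) | ∃ s, ⇑σ = M.actWord s}

/-- The dual automaton group `G_{∂A}`. -/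
def dualAutGroup (M : Mealy S X) : Subgroup (Equiv.Perm (List S)) :=
  Subgroup.closure {τ : Equiv.Perm (List S) | ∃ x, ⇑τ = M.dualActWord x}

end Mealy

/-- Two families `gS`, `gX` generating a group, with free and trivially intersecting spans, such
that every (signed) state can be pushed to the right of every (signed) letter. -/
structure IsSquareGenerating {S X G : Type*} [Group G] (gS : S → G) (gX : X → G) : Prop where
  pos_pos : ∀ s x, ∃ y t, gS s * gX x = gX y * gS t
  pos_neg : ∀ s x, ∃ y t, gS s * (gX x)⁻¹ = (gX y)⁻¹ * gS t
  neg_pos : ∀ s x, ∃ y t, (gS s)⁻¹ * gX x = gX y * (gS t)⁻¹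
  neg_neg : ∀ s x, ∃ y t, (gS s)⁻¹ * (gX x)⁻¹ = (gX y)⁻¹ * (gS t)⁻¹
  closure_eq_top : Subgroup.closure (Set.range gS ∪ Set.range gX) = ⊤
  disjoint : Disjoint (Subgroup.closure (Set.range gS)) (Subgroup.closure (Set.range gX))
  injective_lift_left : Function.Injective (FreeGroup.lift gS)
  injective_lift_right : Function.Injective (FreeGroup.lift gX)

namespace IsSquareGenerating

variable {S X G : Type*} [Group G] {gS : S → G} {gX : X → G}

theorem symm (h : IsSquareGenerating gS gX) : IsSquareGenerating gX gS where
  pos_pos x s := by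
    obtain ⟨y, t, e⟩ := h.neg_neg s x
    exact ⟨t, y, by simpa using congrArg (·⁻¹) e⟩
  pos_neg x s := by
    obtain ⟨y, t, e⟩ := h.pos_neg s x
    exact ⟨t, y, by simpa using congrArg (·⁻¹) e⟩
  neg_pos x s := by
    obtain ⟨y, t, e⟩ := h.neg_pos s x
    exact ⟨t, y, by simpa using congrArg (·⁻¹) e⟩
  neg_neg x s := by
    obtain ⟨y, t, e⟩ := h.pos_pos s x
    exact ⟨t, y, by simpa using congrArg (·⁻¹) e⟩
  closure_eq_top := by rw [Set.union_comm]; exact h.closure_eq_top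
  disjoint := h.disjoint.symm
  injective_lift_left := h.injective_lift_right
  injective_lift_right := h.injective_lift_left

theorem injective_left (h : IsSquareGenerating gS gX) : Function.Injective gS := fun s t e =>
  FreeGroup.of_injective (h.injective_lift_left (by simpa using e))

theorem eq_of_mul_inv_mem (h : IsSquareGenerating gS gX) {p q : G}
    (hp : p ∈ Subgroup.closure (Set.range gS)) (hq : q ∈ Subgroup.closure (Set.range gS))
    (hpq : p * q⁻¹ ∈ Subgroup.closure (Set.range gX)) : p = q :=
  mul_inv_eq_one.1 (Subgroup.disjoint_def.1 h.disjoint (mul_mem hp (inv_mem hq)) hpq)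

end IsSquareGenerating

section Ball

open scoped Pointwise

/-- The ball of radius `n` for the word metric on `⟨range g⟩`. -/
def wordBall {X G : Type*} [Group G] (g : X → G) (n : ℕ) : Set G :=
  ({1} ∪ (Set.range g ∪ (Set.range g)⁻¹)) ^ n

variable {X G : Type*} [Group G] {g : X → G}

theorem finite_wordBall [Finite X] (n : ℕ) : (wordBall g n).Finite := by
  induction n with
  | zero => simp [wordBall]
  | succ n ih =>
    rw [wordBall, pow_succ]
    exact ih.mul ((Set.finite_singleton 1).union
      ((Set.finite_range g).union (Set.finite_range g).inv))

theorem wordBall_mono {m n : ℕ} (h : m ≤ n) : wordBall g m ⊆ wordBall g n :=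
  Set.pow_subset_pow_right (by simp) h

theorem wordBall_subset_closure (n : ℕ) :
    wordBall g n ⊆ Subgroup.closure (Set.range g) := by
  induction n with
  | zero => simp [wordBall]
  | succ n ih =>
    rw [wordBall, pow_succ']
    rintro _ ⟨x, hx, y, hy, rfl⟩
    refine mul_mem ?_ (ih hy)
    rcases hx with rfl | hx | hx
    · exact one_mem _
    · exact Subgroup.subset_closure hx
    · exact inv_mem_iff.1 (Subgroup.subset_closure hx)

theorem exists_mem_wordBall {x : G} (hx : x ∈ Subgroup.closure (Set.range g)) :
    ∃ n, x ∈ wordBall g n := by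
  induction hx using Subgroup.closure_induction_left with
  | one => exact ⟨0, by simp [wordBall]⟩
  | mul_left x hx y _ ih =>
    obtain ⟨n, hn⟩ := ih
    exact ⟨n + 1, by rw [wordBall, pow_succ']; exact Set.mul_mem_mul (by simp_all) hn⟩
  | inv_mul_cancel x hx y _ ih =>
    obtain ⟨n, hn⟩ := ih
    exact ⟨n + 1, by rw [wordBall, pow_succ']; exact Set.mul_mem_mul (by simp_all) hn⟩

theorem wordBall_push {P : Set G}
    (hP : ∀ p ∈ P, ∀ x, (∃ y, ∃ q ∈ P, p * g x = g y * q) ∧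
      ∃ y, ∃ q ∈ P, p * (g x)⁻¹ = (g y)⁻¹ * q) (n : ℕ) :
    ∀ p ∈ P, ∀ w ∈ wordBall g n, ∃ w' ∈ wordBall g n, ∃ q ∈ P, p * w = w' * q := by
  induction n with
  | zero =>
    intro p hp w hw
    obtain rfl : w = 1 := by simpa [wordBall] using hw
    exact ⟨1, hw, p, hp, by simp⟩
  | succ n ih =>
    intro p hp w hw
    rw [wordBall, pow_succ'] at hw ⊢
    obtain ⟨x, hx, v, hv, rfl⟩ := hw
    obtain ⟨x', hx', q, hq, e⟩ : ∃ x' ∈ ({1} ∪ (Set.range g ∪ (Set.range g)⁻¹) : Set G),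
        ∃ q ∈ P, p * x = x' * q := by
      rcases hx with rfl | ⟨x, rfl⟩ | ⟨x, hx⟩
      · exact ⟨1, by simp, p, hp, by simp⟩
      · obtain ⟨y, q, hq, e⟩ := (hP p hp x).1
        exact ⟨g y, by simp, q, hq, e⟩
      · obtain ⟨y, q, hq, e⟩ := (hP p hp x).2
        exact ⟨(g y)⁻¹, by simp, q, hq, by rw [← e, hx, inv_inv]⟩
    obtain ⟨v', hv', r, hr, e'⟩ := ih q hq v hv
    exact ⟨x' * v', Set.mul_mem_mul hx' hv', r, hr, by
      simp only [← mul_assoc, e]; rw [mul_assoc, e', mul_assoc]⟩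

end Ball

namespace IsSquareGenerating

variable {S X G : Type*} [Group G] {gS : S → G} {gX : X → G}

theorem push (h : IsSquareGenerating gS gX) {n : ℕ} {w : G} (hw : w ∈ wordBall gX n) (s : S) :
    ∃ w' ∈ wordBall gX n, ∃ t, gS s * w = w' * gS t := by
  obtain ⟨w', hw', _, ⟨t, rfl⟩, e⟩ := wordBall_push (P := Set.range gS) (by
    rintro _ ⟨s, rfl⟩ x
    obtain ⟨y, t, e⟩ := h.pos_pos s x
    obtain ⟨y', t', e'⟩ := h.pos_neg s x
    exact ⟨⟨y, _, ⟨t, rfl⟩, e⟩, ⟨y', _, ⟨t', rfl⟩, e'⟩⟩) n _ ⟨s, rfl⟩ w hw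
  exact ⟨w', hw', t, e⟩

theorem push_inv (h : IsSquareGenerating gS gX) {n : ℕ} {w : G} (hw : w ∈ wordBall gX n)
    (s : S) : ∃ w' ∈ wordBall gX n, ∃ t, (gS s)⁻¹ * w = w' * (gS t)⁻¹ := by
  obtain ⟨w', hw', _, ⟨t, rfl⟩, e⟩ := wordBall_push (P := Set.range fun s => (gS s)⁻¹) (by
    rintro _ ⟨s, rfl⟩ x
    obtain ⟨y, t, e⟩ := h.neg_pos s x
    obtain ⟨y', t', e'⟩ := h.neg_neg s x
    exact ⟨⟨y, _, ⟨t, rfl⟩, e⟩, ⟨y', _, ⟨t', rfl⟩, e'⟩⟩) n _ ⟨s, rfl⟩ w hw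
  exact ⟨w', hw', t, e⟩

theorem mem_closure (s : S) : gS s ∈ Subgroup.closure (Set.range gS) :=
  Subgroup.subset_closure ⟨s, rfl⟩

theorem conj_mem_wordBall (h : IsSquareGenerating gS gX) {n : ℕ} {w : G}
    (hw : w ∈ wordBall gX n) {s : S}
    (hs : gS s * w * (gS s)⁻¹ ∈ Subgroup.closure (Set.range gX)) :
    gS s * w * (gS s)⁻¹ ∈ wordBall gX n := by
  obtain ⟨w', hw', t, e⟩ := h.push hw s
  have : gS t = gS s := h.eq_of_mul_inv_mem (mem_closure t) (mem_closure s) <| by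
    have := mul_mem (inv_mem (wordBall_subset_closure n hw')) hs
    rwa [e, mul_assoc, inv_mul_cancel_left] at this
  rwa [e, this, mul_inv_cancel_right]

theorem inv_conj_mem_wordBall (h : IsSquareGenerating gS gX) {n : ℕ} {w : G}
    (hw : w ∈ wordBall gX n) {s : S}
    (hs : (gS s)⁻¹ * w * gS s ∈ Subgroup.closure (Set.range gX)) :
    (gS s)⁻¹ * w * gS s ∈ wordBall gX n := by
  obtain ⟨w', hw', t, e⟩ := h.push_inv hw s
  have : (gS t)⁻¹ = (gS s)⁻¹ :=
    h.eq_of_mul_inv_mem (inv_mem (mem_closure t)) (inv_mem (mem_closure s)) <| by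
      have := mul_mem (inv_mem (wordBall_subset_closure n hw')) hs
      rwa [e, mul_assoc, inv_mul_cancel_left, ← inv_inv (gS s)] at this
  rwa [e, this, inv_mul_cancel_right]

section TwoStates

variable {a b : S}

theorem conj_mem_or_swap (h : IsSquareGenerating gS gX) (hab : a ≠ b)
    (hS : ∀ s, s = a ∨ s = b) {w : G} (hw : w ∈ Subgroup.closure (Set.range gX)) :
    (gS a * w * (gS a)⁻¹ ∈ Subgroup.closure (Set.range gX) ∧
      gS b * w * (gS b)⁻¹ ∈ Subgroup.closure (Set.range gX)) ∨
    (gS a * w * (gS a)⁻¹ ∉ Subgroup.closure (Set.range gX) ∧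
      gS a * w * (gS b)⁻¹ ∈ Subgroup.closure (Set.range gX)) := by
  obtain ⟨n, hn⟩ := exists_mem_wordBall hw
  obtain ⟨w₁, hw₁, s, e₁⟩ := h.push hn a
  obtain ⟨w₂, hw₂, t, e₂⟩ := h.push hn b
  replace hw₁ := wordBall_subset_closure n hw₁
  replace hw₂ := wordBall_subset_closure n hw₂
  have hne : gS a ≠ gS b := fun e => hab (h.injective_left e)
  rcases hS s with hs | hs <;> rw [hs] at e₁
  · left
    rcases hS t with ht | ht <;> rw [ht] at e₂
    · refine absurd (h.eq_of_mul_inv_mem (mem_closure a) (mem_closure b) ?_) hne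
      have : gS a * (gS b)⁻¹ = w₁ * w₂⁻¹ := by
        rw [← mul_inv_eq_iff_eq_mul] at e₁ e₂
        rw [← e₁, ← e₂]
        group
      exact this ▸ mul_mem hw₁ (inv_mem hw₂)
    · rw [e₁, e₂]
      simpa using ⟨hw₁, hw₂⟩
  · right
    rw [e₁]
    refine ⟨fun hm => hne (h.eq_of_mul_inv_mem (mem_closure b) (mem_closure a) ?_).symm, by simpa⟩
    simpa [mul_assoc] using mul_mem (inv_mem hw₁) hm

theorem inv_conj_mem_of_inv_conj_mem (h : IsSquareGenerating gS gX) (hab : a ≠ b)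
    (hS : ∀ s, s = a ∨ s = b) {w : G} (hw : w ∈ Subgroup.closure (Set.range gX))
    (hb : (gS b)⁻¹ * w * gS b ∈ Subgroup.closure (Set.range gX)) :
    (gS a)⁻¹ * w * gS a ∈ Subgroup.closure (Set.range gX) := by
  obtain ⟨n, hn⟩ := exists_mem_wordBall hw
  obtain ⟨w₁, hw₁, s, e⟩ := h.push_inv hn a
  replace hw₁ := wordBall_subset_closure n hw₁
  rcases hS s with hs | hs <;> rw [hs] at e
  · rwa [e, inv_mul_cancel_right]
  · refine absurd (h.injective_left (inv_injective (h.eq_of_mul_inv_mem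
      (inv_mem (mem_closure a)) (inv_mem (mem_closure b)) ?_))) hab
    have : (gS a)⁻¹ * (gS b)⁻¹⁻¹ = w₁ * ((gS b)⁻¹ * w * gS b)⁻¹ := by
      rw [← mul_inv_eq_iff_eq_mul] at e
      rw [← e]
      group
    exact this ▸ mul_mem hw₁ (inv_mem hb)

/-- The elements of the group of letters that `g` conjugates into the group of letters; for
`g = gS a` this is the stabilizer of the state `a`. -/
def letterStabilizer (gX : X → G) (g : G) : Subgroup G :=
  Subgroup.closure (Set.range gX) ⊓
    (Subgroup.closure (Set.range gX)).comap (MulAut.conj g).toMonoidHom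

theorem mem_letterStabilizer {g w : G} : w ∈ letterStabilizer gX g ↔
    w ∈ Subgroup.closure (Set.range gX) ∧ g * w * g⁻¹ ∈ Subgroup.closure (Set.range gX) :=
  Iff.rfl

theorem mul_mem_letterStabilizer (h : IsSquareGenerating gS gX) (hab : a ≠ b)
    (hS : ∀ s, s = a ∨ s = b) {v w : G} (hv : v ∈ Subgroup.closure (Set.range gX))
    (hw : w ∈ Subgroup.closure (Set.range gX)) (hv' : v ∉ letterStabilizer gX (gS a))
    (hw' : w ∉ letterStabilizer gX (gS a)) : v * w ∈ letterStabilizer gX (gS a) := by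
  have key : ∀ u ∈ Subgroup.closure (Set.range gX), u ∉ letterStabilizer gX (gS a) →
      gS a * u * (gS b)⁻¹ ∈ Subgroup.closure (Set.range gX) := fun u hu hu' =>
    (h.conj_mem_or_swap hab hS hu).elim (fun H => absurd ⟨hu, H.1⟩ hu') And.right
  have h₁ := key v hv hv'
  have h₂ := key _ (inv_mem hw) (fun H => hw' (inv_mem_iff.1 H))
  have : gS a * (v * w) * (gS a)⁻¹ =
      gS a * v * (gS b)⁻¹ * (gS a * w⁻¹ * (gS b)⁻¹)⁻¹ := by group
  exact mem_letterStabilizer.2 ⟨mul_mem hv hw, this ▸ mul_mem h₁ (inv_mem h₂)⟩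

theorem fg_letterStabilizer [Finite X] (h : IsSquareGenerating gS gX) (hab : a ≠ b)
    (hS : ∀ s, s = a ∨ s = b) : (letterStabilizer gX (gS a)).FG := by
  set H := Subgroup.closure (Set.range gX) with hH
  have hle : letterStabilizer gX (gS a) ≤ H := inf_le_left
  have : Group.FG H := by
    rw [Group.fg_iff_subgroup_fg]
    exact ⟨(Set.finite_range gX).toFinset, by simp [hH]⟩
  have : ((letterStabilizer gX (gS a)).subgroupOf H).FiniteIndex := by
    by_cases hall : H ≤ letterStabilizer gX (gS a)
    · rw [Subgroup.subgroupOf_eq_top.2 hall]; infer_instance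
    · obtain ⟨v, hv, hv'⟩ := SetLike.not_le_iff_exists.1 hall
      refine ⟨?_⟩
      rw [Subgroup.index_eq_two_iff.2 ⟨⟨v, hv⟩, fun w => ?_⟩]
      · norm_num
      · simp only [Subgroup.mem_subgroupOf, Subgroup.coe_mul]
        by_cases hw : (w : G) ∈ letterStabilizer gX (gS a)
        · exact Or.inr ⟨hw, fun H => hv' ((Subgroup.mul_mem_cancel_left _ hw).1 H)⟩
        · exact Or.inl ⟨h.mul_mem_letterStabilizer hab hS w.2 hv hw hv', hw⟩
  have := Subgroup.fg_of_index_ne_zero ((letterStabilizer gX (gS a)).subgroupOf H)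
  rw [← Group.fg_iff_subgroup_fg]
  exact Group.fg_of_surjective (f := (Subgroup.subgroupOfEquivOfLe hle).toMonoidHom)
    (Subgroup.subgroupOfEquivOfLe hle).surjective

theorem conj_mem_letterStabilizer (h : IsSquareGenerating gS gX) (hab : a ≠ b)
    (hS : ∀ s, s = a ∨ s = b) {n : ℕ} {w : G}
    (hw : w ∈ letterStabilizer gX (gS a)) (hwn : w ∈ wordBall gX n) :
    (gS a)⁻¹ * gS b * w * ((gS a)⁻¹ * gS b)⁻¹ ∈ letterStabilizer gX (gS a) ∧
    (gS a)⁻¹ * gS b * w * ((gS a)⁻¹ * gS b)⁻¹ ∈ wordBall gX n := by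
  have h₁ : gS b * w * (gS b)⁻¹ ∈ Subgroup.closure (Set.range gX) :=
    (h.conj_mem_or_swap hab hS hw.1).elim And.right fun H => absurd hw.2 H.1
  have h₂ := h.inv_conj_mem_of_inv_conj_mem hab hS h₁ (by simpa [mul_assoc] using hw.1)
  have h₃ := h.inv_conj_mem_wordBall (h.conj_mem_wordBall hwn h₁) h₂
  have e : (gS a)⁻¹ * gS b * w * ((gS a)⁻¹ * gS b)⁻¹ =
    (gS a)⁻¹ * (gS b * w * (gS b)⁻¹) * gS a := by group
  rw [e]
  exact ⟨mem_letterStabilizer.2 ⟨h₂, by simpa [mul_assoc] using h₁⟩, h₃⟩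

/-- Conjugation by `a⁻¹ b` preserves word length on the finitely generated stabilizer of `a`,
so some power of `a⁻¹ b` centralizes it. -/
theorem exists_pow_commute [Finite X] (h : IsSquareGenerating gS gX) (hab : a ≠ b)
    (hS : ∀ s, s = a ∨ s = b) :
    ∃ k, 0 < k ∧ ∀ w ∈ letterStabilizer gX (gS a), Commute (((gS a)⁻¹ * gS b) ^ k) w := by
  obtain ⟨F, hF⟩ := h.fg_letterStabilizer hab hS
  have hFH : ∀ w ∈ F, w ∈ letterStabilizer gX (gS a) := fun w hw =>
    hF ▸ Subgroup.subset_closure hw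
  obtain ⟨n, hn⟩ : ∃ n, ∀ w ∈ F, w ∈ wordBall gX n := by
    choose! N hN using fun w (hw : w ∈ F) => exists_mem_wordBall (hFH w hw).1
    exact ⟨F.sup N, fun w hw => wordBall_mono (Finset.le_sup hw) (hN w hw)⟩
  let E : Set G := {w | w ∈ letterStabilizer gX (gS a) ∧ w ∈ wordBall gX n}
  have : Finite E := (finite_wordBall n).subset fun w hw => hw.2
  let f : E → E := fun w => ⟨_, h.conj_mem_letterStabilizer hab hS w.2.1 w.2.2⟩
  have hf : Function.Injective f := fun v w e => Subtype.ext (by simpa [f] using e)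
  let e : Equiv.Perm E := Equiv.ofBijective f (Finite.injective_iff_bijective.1 hf)
  have hpow : ∀ (k : ℕ) (w : E), (((e ^ k) w : E) : G) =
      ((gS a)⁻¹ * gS b) ^ k * w * (((gS a)⁻¹ * gS b) ^ k)⁻¹ := by
    intro k
    induction k with
    | zero => simp
    | succ k ih =>
      intro w
      rw [pow_succ', Equiv.Perm.mul_apply]
      change (gS a)⁻¹ * gS b * ((e ^ k) w : E) * ((gS a)⁻¹ * gS b)⁻¹ = _
      rw [ih, pow_succ']
      simp only [mul_inv_rev, mul_assoc]
  refine ⟨orderOf e, orderOf_pos e, fun w hw => ?_⟩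
  rw [← hF] at hw
  have : Subgroup.closure (F : Set G) ≤
      Subgroup.centralizer {((gS a)⁻¹ * gS b) ^ orderOf e} := by
    rw [Subgroup.closure_le]
    intro w hw
    have := hpow (orderOf e) ⟨w, hFH w hw, hn w hw⟩
    rw [pow_orderOf_eq_one, Equiv.Perm.one_apply, eq_mul_inv_iff_mul_eq] at this
    exact Subgroup.mem_centralizer_singleton_iff.2 this
  exact (Subgroup.mem_centralizer_singleton_iff.1 (this hw)).symm

theorem exists_mem_notMem_letterStabilizer [Finite X] (h : IsSquareGenerating gS gX)
    (hab : a ≠ b) (hS : ∀ s, s = a ∨ s = b)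
    (hL : ∀ L : Subgroup G, L.Normal → L ≤ Subgroup.closure (Set.range gX) →
      L.relIndex (Subgroup.closure (Set.range gX)) = 0)
    (N : Subgroup G) (hN : N.Normal) (hN' : N.FiniteIndex) :
    ∃ w ∈ N, w ∈ Subgroup.closure (Set.range gX) ∧ w ∉ letterStabilizer gX (gS a) := by
  by_contra! hcon
  set H := Subgroup.closure (Set.range gX) with hH
  have hconj : ∀ s, ∀ w ∈ N ⊓ H, gS s * w * (gS s)⁻¹ ∈ N ⊓ H := by
    intro s w hw
    have := hcon w hw.1 hw.2
    refine ⟨hN.conj_mem w hw.1 _, ?_⟩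
    rcases hS s with rfl | rfl
    · exact this.2
    · exact (h.conj_mem_or_swap hab hS hw.2).elim And.right fun H => absurd this.2 H.1
  have hinv : ∀ s, ∀ w ∈ N ⊓ H, (gS s)⁻¹ * w * gS s ∈ N ⊓ H := by
    intro s w hw
    obtain ⟨n, hn⟩ := exists_mem_wordBall hw.2
    let E : Set G := {w | w ∈ N ⊓ H ∧ w ∈ wordBall gX n}
    have : Finite E := (finite_wordBall n).subset fun w hw => hw.2
    let f : E → E := fun v => ⟨gS s * v * (gS s)⁻¹, hconj s v v.2.1,
      h.conj_mem_wordBall v.2.2 (hconj s v v.2.1).2⟩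
    have hf : Function.Injective f := fun v w e => Subtype.ext (by simpa [f] using e)
    obtain ⟨v, hv⟩ := (Finite.injective_iff_surjective.1 hf) ⟨w, hw, hn⟩
    have : gS s * v * (gS s)⁻¹ = w := congrArg Subtype.val hv
    have hv' := v.2.1
    rw [← this]
    simpa [mul_assoc] using hv'
  have hnormal : (N ⊓ H).Normal := by
    rw [← Subgroup.normalizer_eq_top_iff, ← top_le_iff, ← h.closure_eq_top, Subgroup.closure_le]
    rintro _ (⟨s, rfl⟩ | ⟨x, rfl⟩)
    · refine Subgroup.mem_normalizer_iff.2 fun w => ⟨hconj s w, fun hw => ?_⟩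
      simpa [mul_assoc] using hinv s _ hw
    · have hx : gX x ∈ H := mem_closure x
      refine Subgroup.mem_normalizer_iff.2 fun w => ?_
      rw [Subgroup.mem_inf, Subgroup.mem_inf, ← hN.mem_comm_iff, mul_assoc,
        Subgroup.mul_mem_cancel_left _ hx, Subgroup.mul_mem_cancel_right _ (inv_mem hx)]
      simp
  refine absurd (hL _ hnormal inf_le_right) ?_
  rw [Subgroup.inf_relIndex_right]
  have : (N.subgroupOf H).FiniteIndex := inferInstance
  exact this.index_ne_zero

open scoped commutatorElement in
theorem freeGroup_commutator_ne_one {S : Type*} {a b : S} (hab : a ≠ b) {k : ℕ} (hk : 0 < k) :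
    ⁅((FreeGroup.of a)⁻¹ * FreeGroup.of b) ^ k, FreeGroup.of a * (FreeGroup.of b)⁻¹⁆ ≠ 1 := by
  classical
  intro hc
  let T : Equiv.Perm ℚ := Equiv.addRight 1
  let D : Equiv.Perm ℚ := Equiv.mulRight₀ 2 two_ne_zero
  let φ : FreeGroup S →* Equiv.Perm ℚ := FreeGroup.lift fun s => if s = a then T else D * T
  have hφ := congrArg φ hc
  have ha : φ (FreeGroup.of a) = T := by simp [φ]
  have hb : φ (FreeGroup.of b) = D * T := by simp [φ, hab.symm]
  have hpow : ∀ (n : ℕ) (q : ℚ), ((T⁻¹ * (D * T)) ^ n) q = 2 ^ n * (q + 1) - 1 := by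
    intro n
    induction n with
    | zero => simp
    | succ n ih =>
      intro q
      rw [pow_succ', Equiv.Perm.mul_apply, ih]
      change (2 ^ n * (q + 1) - 1 + 1) * 2 + -1 = _
      ring
  have hd : T * (D * T)⁻¹ = D⁻¹ := by group
  rw [map_commutatorElement, map_pow, map_mul, map_mul, map_inv, map_inv, ha, hb, map_one, hd,
    commutatorElement_eq_one_iff_commute] at hφ
  have h₀ := Equiv.congr_fun hφ.inv_right.eq 0
  rw [inv_inv, Equiv.Perm.mul_apply, Equiv.Perm.mul_apply, hpow, hpow] at h₀
  replace h₀ : (2 : ℚ) ^ k * (0 * 2 + 1) - 1 = (2 ^ k * (0 + 1) - 1) * 2 := h₀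
  have h₁ : (1 : ℚ) < 2 ^ k := one_lt_pow₀ (by norm_num) hk.ne'
  linarith

open scoped commutatorElement in
theorem exists_ne_one_mem_of_finiteIndex [Finite X] (h : IsSquareGenerating gS gX)
    (hcard : Nat.card S = 2)
    (hL : ∀ L : Subgroup G, L.Normal → L ≤ Subgroup.closure (Set.range gX) →
      L.relIndex (Subgroup.closure (Set.range gX)) = 0) :
    ∃ γ : G, γ ≠ 1 ∧ ∀ N : Subgroup G, N.Normal → N.FiniteIndex → γ ∈ N := by
  obtain ⟨a, b, hab, huniv⟩ := Nat.card_eq_two_iff.1 hcard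
  have hS : ∀ s, s = a ∨ s = b := fun s => by
    have : s ∈ ({a, b} : Set S) := huniv ▸ Set.mem_univ s
    simpa using this
  obtain ⟨k, hk, hcomm⟩ := h.exists_pow_commute hab hS
  refine ⟨⁅((gS a)⁻¹ * gS b) ^ k, gS a * (gS b)⁻¹⁆, fun hγ => ?_, fun N hN hN' => ?_⟩
  · refine freeGroup_commutator_ne_one hab hk (h.injective_lift_left ?_)
    simpa [map_commutatorElement] using hγ
  · obtain ⟨l, hlN, hlH, hl⟩ := h.exists_mem_notMem_letterStabilizer hab hS hL N hN hN'
    have hw : gS a * l * (gS b)⁻¹ ∈ Subgroup.closure (Set.range gX) :=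
      (h.conj_mem_or_swap hab hS hlH).elim (fun H => absurd ⟨hlH, H.1⟩ hl) And.right
    have hq : ((l : G) : G ⧸ N) = 1 := (QuotientGroup.eq_one_iff l).2 hlN
    obtain ⟨w, hw, e⟩ : ∃ w ∈ letterStabilizer gX (gS a),
        ((gS a * (gS b)⁻¹ : G) : G ⧸ N) = w := by
      by_cases hw' : gS a * l * (gS b)⁻¹ ∈ letterStabilizer gX (gS a)
      · exact ⟨_, hw', by simp [hq]⟩
      · exact ⟨_, h.mul_mem_letterStabilizer hab hS hw hlH hw' hl, by simp [hq]⟩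
    rw [← QuotientGroup.eq_one_iff, ← QuotientGroup.mk'_apply, map_commutatorElement,
      commutatorElement_eq_one_iff_commute, QuotientGroup.mk'_apply, QuotientGroup.mk'_apply, e]
    exact (hcomm w hw).map (QuotientGroup.mk' N)

end TwoStates

end IsSquareGenerating

namespace Mealy

variable {S X : Type}

/-- The action of the free group on the states on pairs of a letter and a free group element:
`u • (x, 1) = (y, v)` when `u x = y v` in the square-complex group. -/
noncomputable def crossPerm (M : Mealy S X) (ho : ∀ s, Function.Bijective (M.o s)) :
    FreeGroup S →* Equiv.Perm (X × FreeGroup S) :=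
  FreeGroup.lift fun s =>
    { toFun := fun p => (M.o s p.1, FreeGroup.of (M.t s p.1) * p.2)
      invFun := fun p => ((Equiv.ofBijective _ (ho s)).symm p.1,
        (FreeGroup.of (M.t s ((Equiv.ofBijective _ (ho s)).symm p.1)))⁻¹ * p.2)
      left_inv := fun p => by
        have : (Equiv.ofBijective _ (ho s)).symm (M.o s p.1) = p.1 :=
          Equiv.ofBijective_symm_apply_apply _ (ho s) p.1
        simp [this]
      right_inv := fun p => by
        have : M.o s ((Equiv.ofBijective _ (ho s)).symm p.1) = p.1 :=
          Equiv.ofBijective_apply_symm_apply _ (ho s) p.1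
        simp [this] }

section CrossPerm

variable {M : Mealy S X} (ho : ∀ s, Function.Bijective (M.o s))

theorem crossPerm_of (s : S) (p : X × FreeGroup S) :
    M.crossPerm ho (FreeGroup.of s) p = (M.o s p.1, FreeGroup.of (M.t s p.1) * p.2) := by
  simp [crossPerm]

theorem crossPerm_apply_mul (u : FreeGroup S) : ∀ (p : X × FreeGroup S) (w : FreeGroup S),
    M.crossPerm ho u (p.1, p.2 * w) =
      ((M.crossPerm ho u p).1, (M.crossPerm ho u p).2 * w) := by
  induction u using FreeGroup.induction_on with
  | C1 => simp
  | of s => intro p w; simp [crossPerm_of, mul_assoc]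
  | inv_of s ih =>
    intro p w
    rw [map_inv, Equiv.Perm.inv_eq_iff_eq, ih ((M.crossPerm ho (FreeGroup.of s))⁻¹ p) w]
    simp
  | mul u v hu hv => intro p w; simp [hv p w, hu (M.crossPerm ho v p) w]

/-- Moving `x⁻¹` instead of `x` through words over the states is governed by a second automaton
`M'`, and the two operations are mutually inverse. -/
theorem crossPerm_flip {M' : Mealy S X} (ho' : ∀ s, Function.Bijective (M'.o s))
    (ht : ∀ s x, M'.t (M.t s x) x = s) (hot : ∀ s x, M'.o (M.t s x) x = M.o s x)
    (u : FreeGroup S) : ∀ (x y : X) (v : FreeGroup S), M.crossPerm ho u (x, 1) = (y, v) →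
      M'.crossPerm ho' v (x, 1) = (y, u) := by
  induction u using FreeGroup.induction_on with
  | C1 =>
    rintro x y v e
    obtain ⟨rfl, rfl⟩ : x = y ∧ 1 = v := by simpa using e
    simp
  | of s =>
    rintro x y v e
    obtain ⟨rfl, rfl⟩ : M.o s x = y ∧ FreeGroup.of (M.t s x) = v := by
      simpa [crossPerm_of] using e
    simp [crossPerm_of, ht, hot]
  | inv_of s ih =>
    rintro x y v e
    rw [map_inv, Equiv.Perm.inv_eq_iff_eq] at e
    have h₁ := crossPerm_apply_mul ho (FreeGroup.of s) (y, v) v⁻¹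
    rw [← e] at h₁
    have h₂ := ih y x v⁻¹ (by simpa using h₁)
    rw [map_inv, Equiv.Perm.inv_eq_iff_eq] at h₂
    have h₃ := crossPerm_apply_mul ho' v (x, FreeGroup.of s) (FreeGroup.of s)⁻¹
    rw [← h₂] at h₃
    simpa using h₃
  | mul u₁ u₂ h₁ h₂ =>
    rintro x y v e
    obtain ⟨y₂, v₂, e₂⟩ : ∃ y₂ v₂, M.crossPerm ho u₂ (x, 1) = (y₂, v₂) := ⟨_, _, rfl⟩
    obtain ⟨y₁, v₁, e₁⟩ : ∃ y₁ v₁, M.crossPerm ho u₁ (y₂, 1) = (y₁, v₁) := ⟨_, _, rfl⟩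
    have h₃ := crossPerm_apply_mul ho u₁ (y₂, 1) v₂
    have h₄ := crossPerm_apply_mul ho' v₁ (y₂, 1) u₂
    rw [map_mul, Equiv.Perm.mul_apply, e₂] at e
    rw [e₁] at h₃
    rw [h₁ _ _ _ e₁] at h₄
    simp only [one_mul] at h₃ h₄
    obtain ⟨rfl, rfl⟩ : y₁ = y ∧ v₁ * v₂ = v := by simpa [h₃] using e
    rw [map_mul, Equiv.Perm.mul_apply, h₂ _ _ _ e₂, h₄]

end CrossPerm

/-- The automaton governing how inverses of letters move through states. -/
noncomputable def letterInverse (M : Mealy S X) (hb : M.Bireversible) : Mealy S X where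
  o s x := M.o ((Equiv.ofBijective _ (hb.2.1 x)).symm s) x
  t s x := (Equiv.ofBijective _ (hb.2.1 x)).symm s

section LetterPerm

variable {M : Mealy S X} (hb : M.Bireversible)

theorem t_letterInverse (s : S) (x : X) : M.t ((M.letterInverse hb).t s x) x = s :=
  Equiv.ofBijective_apply_symm_apply _ (hb.2.1 x) s

theorem letterInverse_t (s : S) (x : X) : (M.letterInverse hb).t (M.t s x) x = s :=
  Equiv.ofBijective_symm_apply_apply _ (hb.2.1 x) s

theorem o_letterInverse (s : S) (x : X) :
    M.o ((M.letterInverse hb).t s x) x = (M.letterInverse hb).o s x := rfl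

theorem letterInverse_o (s : S) (x : X) : (M.letterInverse hb).o (M.t s x) x = M.o s x := by
  rw [← o_letterInverse, letterInverse_t]

theorem bijective_letterInverse_o (s : S) : Function.Bijective ((M.letterInverse hb).o s) := by
  refine ⟨fun x y e => ?_, fun y => ?_⟩
  · have := @hb.2.2.1 ((M.letterInverse hb).t s x, x) ((M.letterInverse hb).t s y, y)
      (Prod.ext e (by simp [t_letterInverse]))
    exact congrArg Prod.snd this
  · obtain ⟨⟨s', x⟩, e⟩ := hb.2.2.2 (y, s)
    simp only [Prod.mk.injEq] at e
    exact ⟨x, by rw [← e.2, letterInverse_o, e.1]⟩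

/-- The permutation `u ↦ v` of the free group on the states, where `u x = y v`. -/
noncomputable def letterPerm (x : X) : Equiv.Perm (FreeGroup S) where
  toFun u := (M.crossPerm hb.1 u (x, 1)).2
  invFun u := ((M.letterInverse hb).crossPerm (bijective_letterInverse_o hb) u (x, 1)).2
  left_inv u := congrArg Prod.snd <| crossPerm_flip hb.1 (bijective_letterInverse_o hb)
    (letterInverse_t hb) (letterInverse_o hb) u x (M.crossPerm hb.1 u (x, 1)).1 _ rfl
  right_inv u := congrArg Prod.snd <| crossPerm_flip (bijective_letterInverse_o hb) hb.1
    (t_letterInverse hb) (o_letterInverse hb) u x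
    ((M.letterInverse hb).crossPerm (bijective_letterInverse_o hb) u (x, 1)).1 _ rfl

theorem letterPerm_mul_of (u : FreeGroup S) (s : S) (x : X) :
    letterPerm hb x (u * FreeGroup.of s) =
      letterPerm hb (M.o s x) u * FreeGroup.of (M.t s x) := by
  have := crossPerm_apply_mul hb.1 u (M.o s x, 1) (FreeGroup.of (M.t s x))
  simp only [one_mul] at this
  simp [letterPerm, crossPerm_of, this]

theorem letterPerm_one (x : X) : letterPerm hb x 1 = 1 := by simp [letterPerm]

theorem genS_mul_genX (M : Mealy S X) (s : S) (x : X) :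
    M.genS s * M.genX x = M.genX (M.o s x) * M.genS (M.t s x) := by
  have : PresentedGroup.mk M.rels (FreeGroup.of (Sum.inl s) * FreeGroup.of (Sum.inr x) *
      (FreeGroup.of (Sum.inl (M.t s x)))⁻¹ * (FreeGroup.of (Sum.inr (M.o s x)))⁻¹) = 1 :=
    PresentedGroup.one_of_mem (Set.mem_iUnion₂.2 ⟨s, x, rfl⟩)
  simp only [map_mul, map_inv, mul_inv_eq_one] at this
  rw [mul_inv_eq_iff_eq_mul] at this
  exact this

/-- A homomorphism out of `π₁(Δ_A)` from a solution of the square relations. -/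
def piLift {G : Type*} [Group G] (M : Mealy S X) (f : S → G) (g : X → G)
    (h : ∀ s x, f s * g x = g (M.o s x) * f (M.t s x)) : M.Pi1 →* G :=
  PresentedGroup.toGroup (f := Sum.elim f g) <| by
    intro r hr
    obtain ⟨s, x, rfl⟩ := Set.mem_iUnion₂.1 hr
    simp [h]

theorem piLift_genS {G : Type*} [Group G] {f : S → G} {g : X → G}
    (h : ∀ s x, f s * g x = g (M.o s x) * f (M.t s x)) (s : S) :
    M.piLift f g h (M.genS s) = f s :=
  PresentedGroup.toGroup.of _

theorem piLift_genX {G : Type*} [Group G] {f : S → G} {g : X → G}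
    (h : ∀ s x, f s * g x = g (M.o s x) * f (M.t s x)) (x : X) :
    M.piLift f g h (M.genX x) = g x :=
  PresentedGroup.toGroup.of _

/-- The action of `π₁(Δ_A)` on the cosets of `⟨X⟩`, identified with the free group on `S`. -/
noncomputable def cosetAction : M.Pi1 →* Equiv.Perm (FreeGroup S) :=
  M.piLift (fun s => (Equiv.mulRight (FreeGroup.of s))⁻¹) (fun x => (letterPerm hb x)⁻¹) <| by
    intro s x
    rw [← mul_inv_rev, ← mul_inv_rev, inv_inj]
    ext1 u
    simp [letterPerm_mul_of]

theorem cosetAction_lift (u : FreeGroup S) :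
    ∀ v, cosetAction hb (FreeGroup.lift M.genS u) v = v * u⁻¹ := by
  induction u using FreeGroup.induction_on with
  | C1 => simp
  | of s =>
    intro v
    rw [FreeGroup.lift_apply_of, cosetAction, piLift_genS]
    simp
  | inv_of s ih =>
    intro v
    rw [map_inv, map_inv, Equiv.Perm.inv_eq_iff_eq, ih]
    simp
  | mul u v hu hv => intro w; simp [hu, hv, mul_assoc]

theorem cosetAction_one_of_mem {g : M.Pi1} (hg : g ∈ Subgroup.closure (Set.range M.genX)) :
    cosetAction hb g 1 = 1 := by
  have : Subgroup.closure (Set.range M.genX) ≤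
      (MulAction.stabilizer (Equiv.Perm (FreeGroup S)) (1 : FreeGroup S)).comap
        (cosetAction hb) := by
    rw [Subgroup.closure_le]
    rintro _ ⟨x, rfl⟩
    change cosetAction hb (M.genX x) 1 = 1
    rw [cosetAction, piLift_genX, Equiv.Perm.inv_eq_iff_eq, letterPerm_one]
  exact this hg

theorem injective_lift_genS (hb : M.Bireversible) : Function.Injective (FreeGroup.lift M.genS) := by
  rw [injective_iff_map_eq_one]
  intro u hu
  simpa [hu] using cosetAction_lift hb u 1

theorem disjoint_closure_genS_genX (hb : M.Bireversible) :
    Disjoint (Subgroup.closure (Set.range M.genS)) (Subgroup.closure (Set.range M.genX)) := by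
  rw [Subgroup.disjoint_def]
  intro g hS hX
  rw [← FreeGroup.range_lift_eq_closure] at hS
  obtain ⟨u, rfl⟩ := hS
  have h₁ := cosetAction_lift hb u 1
  rw [cosetAction_one_of_mem hb hX] at h₁
  obtain rfl : u = 1 := by simpa using h₁
  simp

end LetterPerm

/-- The dual automaton, exchanging states and letters. -/
noncomputable def dual (M : Mealy S X) (hb : M.Bireversible) : Mealy X S where
  o y t := ((Equiv.ofBijective _ hb.2.2).symm (y, t)).1
  t y t := ((Equiv.ofBijective _ hb.2.2).symm (y, t)).2

section Dual

variable {M : Mealy S X} (hb : M.Bireversible)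

theorem dual_o_apply (s : S) (x : X) : (M.dual hb).o (M.o s x) (M.t s x) = s :=
  congrArg Prod.fst (Equiv.ofBijective_symm_apply_apply _ hb.2.2 (s, x))

theorem dual_t_apply (s : S) (x : X) : (M.dual hb).t (M.o s x) (M.t s x) = x :=
  congrArg Prod.snd (Equiv.ofBijective_symm_apply_apply _ hb.2.2 (s, x))

theorem exists_square (hb : M.Bireversible) (y : X) (t : S) : ∃ s x, M.o s x = y ∧ M.t s x = t := by
  obtain ⟨⟨s, x⟩, e⟩ := hb.2.2.2 (y, t)
  exact ⟨s, x, congrArg Prod.fst e, congrArg Prod.snd e⟩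

theorem bireversible_dual : (M.dual hb).Bireversible := by
  refine ⟨fun y => ⟨fun t t' e => ?_, fun s => ?_⟩, fun t => ⟨fun y y' e => ?_, fun x => ?_⟩,
    (Equiv.ofBijective _ hb.2.2).symm.bijective⟩
  · obtain ⟨s, x, rfl, rfl⟩ := exists_square hb y t
    obtain ⟨s', x', e', rfl⟩ := exists_square hb (M.o s x) t'
    rw [dual_o_apply, ← e', dual_o_apply] at e
    subst e
    rw [(hb.1 s).1 e']
  · obtain ⟨x, rfl⟩ := (hb.1 s).2 y
    exact ⟨_, dual_o_apply hb s x⟩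
  · obtain ⟨s, x, rfl, rfl⟩ := exists_square hb y t
    obtain ⟨s', x', rfl, e'⟩ := exists_square hb y' (M.t s x)
    simp only at e
    rw [dual_t_apply, ← e', dual_t_apply] at e
    subst e
    rw [(hb.2.1 x).1 e']
  · obtain ⟨s, rfl⟩ := (hb.2.1 x).2 t
    exact ⟨_, dual_t_apply hb s x⟩

theorem injective_lift_genX (hb : M.Bireversible) : Function.Injective (FreeGroup.lift M.genX) := by
  let φ : M.Pi1 →* (M.dual hb).Pi1 := M.piLift (M.dual hb).genX (M.dual hb).genS <| by
    intro s x
    rw [genS_mul_genX, dual_o_apply, dual_t_apply]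
  have : φ.comp (FreeGroup.lift M.genX) = FreeGroup.lift (M.dual hb).genS :=
    FreeGroup.ext_hom _ _ fun x => by simp [φ, piLift_genX]
  refine Function.Injective.of_comp (f := φ) ?_
  rw [← MonoidHom.coe_comp, this]
  exact injective_lift_genS (bireversible_dual hb)

theorem isSquareGenerating (hb : M.Bireversible) : IsSquareGenerating M.genS M.genX where
  pos_pos s x := ⟨_, _, genS_mul_genX M s x⟩
  pos_neg s x := by
    obtain ⟨t, rfl⟩ := (hb.2.1 x).2 s
    refine ⟨M.o t x, t, ?_⟩
    rw [mul_inv_eq_iff_eq_mul, mul_assoc, genS_mul_genX, inv_mul_cancel_left]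
  neg_pos s x := by
    obtain ⟨y, rfl⟩ := (hb.1 s).2 x
    refine ⟨y, M.t s y, ?_⟩
    rw [inv_mul_eq_iff_eq_mul, ← mul_assoc, genS_mul_genX, mul_inv_cancel_right]
  neg_neg s x := by
    obtain ⟨t, y, rfl, rfl⟩ := exists_square hb x s
    refine ⟨y, t, ?_⟩
    rw [← mul_inv_rev, ← mul_inv_rev, genS_mul_genX]
  closure_eq_top := by
    rw [← PresentedGroup.closure_range_of M.rels, ← Set.Sum.elim_range]
    congr 2
    ext (s | x) <;> rfl
  disjoint := disjoint_closure_genS_genX hb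
  injective_lift_left := injective_lift_genS hb
  injective_lift_right := injective_lift_genX hb

end Dual

section WordPerm

variable {M : Mealy S X} (hb : M.Bireversible)

theorem bijective_actWord (ho : ∀ s, Function.Bijective (M.o s)) (s : S) :
    Function.Bijective (M.actWord s) := by
  constructor
  · intro v
    induction v generalizing s with
    | nil => rintro (_ | ⟨y, w⟩) e <;> simp_all [actWord]
    | cons x v ih =>
      rintro (_ | ⟨y, w⟩) e
      · simp [actWord] at e
      · simp only [actWord, List.cons.injEq] at e
        obtain rfl := (ho s).1 e.1
        rw [ih _ e.2]
  · intro v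
    induction v generalizing s with
    | nil => exact ⟨[], rfl⟩
    | cons y v ih =>
      obtain ⟨x, rfl⟩ := (ho s).2 y
      obtain ⟨w, rfl⟩ := ih (M.t s x)
      exact ⟨x :: w, rfl⟩

/-- The action of the free group on the states on words over the alphabet. -/
noncomputable def wordAction : FreeGroup S →* Equiv.Perm (List X) :=
  FreeGroup.lift fun s => Equiv.ofBijective _ (bijective_actWord hb.1 s)

theorem wordAction_of (s : S) (w : List X) :
    wordAction hb (FreeGroup.of s) w = M.actWord s w := by
  simp [wordAction]

theorem range_wordAction : (wordAction hb).range = M.autGroup := by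
  rw [wordAction, FreeGroup.range_lift_eq_closure, autGroup]
  congr 1
  ext σ
  simp only [Set.mem_range, Set.mem_ofPred_eq]
  refine exists_congr fun s => ⟨fun e => e ▸ rfl, fun e => Equiv.ext fun w => ?_⟩
  rw [e]
  rfl

theorem wordAction_nil (u : FreeGroup S) : wordAction hb u [] = [] := by
  induction u using FreeGroup.induction_on with
  | C1 => rfl
  | of s => rw [wordAction_of, actWord]
  | inv_of s ih => rw [map_inv, Equiv.Perm.inv_eq_iff_eq, ih]
  | mul u v hu hv => rw [map_mul, Equiv.Perm.mul_apply, hv, hu]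

theorem exists_section (u : FreeGroup S) : ∀ x, ∃ y v,
    FreeGroup.lift M.genS u * M.genX x = M.genX y * FreeGroup.lift M.genS v ∧
      ∀ w, wordAction hb u (x :: w) = y :: wordAction hb v w := by
  induction u using FreeGroup.induction_on with
  | C1 => exact fun x => ⟨x, 1, by simp⟩
  | of s =>
    exact fun x => ⟨M.o s x, FreeGroup.of (M.t s x), by simp [genS_mul_genX],
      fun w => by simp only [wordAction_of, actWord]⟩
  | inv_of s _ =>
    intro x
    obtain ⟨y, rfl⟩ := (hb.1 s).2 x
    refine ⟨y, (FreeGroup.of (M.t s y))⁻¹, ?_, fun w => ?_⟩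
    · rw [map_inv, map_inv, FreeGroup.lift_apply_of, FreeGroup.lift_apply_of,
        inv_mul_eq_iff_eq_mul, ← mul_assoc, genS_mul_genX, mul_inv_cancel_right]
    · rw [map_inv, Equiv.Perm.inv_eq_iff_eq, wordAction_of, actWord, ← wordAction_of hb, map_inv,
        ← Equiv.Perm.mul_apply, mul_inv_cancel, Equiv.Perm.one_apply]
  | mul u₁ u₂ h₁ h₂ =>
    intro x
    obtain ⟨y, v₂, e₂, f₂⟩ := h₂ x
    obtain ⟨z, v₁, e₁, f₁⟩ := h₁ y
    refine ⟨z, v₁ * v₂, ?_, fun w => ?_⟩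
    · rw [map_mul, map_mul, mul_assoc, e₂, ← mul_assoc, e₁, mul_assoc]
    · simp [f₁, f₂]

theorem wordAction_eq_one_of_lift_mem {L : Subgroup M.Pi1} (hL : L.Normal)
    (hLS : L ≤ Subgroup.closure (Set.range M.genS)) (w : List X) :
    ∀ u, FreeGroup.lift M.genS u ∈ L → wordAction hb u w = w := by
  induction w with
  | nil => exact fun u _ => wordAction_nil hb u
  | cons x w ih =>
    intro u hu
    obtain ⟨y, v, e, f⟩ := exists_section hb u x
    have hsq := (isSquareGenerating hb).symm
    have hc : (M.genX x)⁻¹ * FreeGroup.lift M.genS u * M.genX x ∈ L := by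
      simpa using hL.conj_mem _ hu (M.genX x)⁻¹
    have hv : FreeGroup.lift M.genS v ∈ Subgroup.closure (Set.range M.genS) := by
      rw [← FreeGroup.range_lift_eq_closure]
      exact ⟨v, rfl⟩
    rw [mul_assoc, e] at hc
    have hxy : x = y := by
      refine hsq.injective_left (inv_injective (hsq.eq_of_mul_inv_mem
        (inv_mem (IsSquareGenerating.mem_closure x))
        (inv_mem (IsSquareGenerating.mem_closure y)) ?_))
      have := mul_mem (hLS hc) (inv_mem hv)
      simpa [mul_assoc] using this
    subst hxy
    rw [inv_mul_cancel_left] at hc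
    rw [f, ih v hc]

theorem finite_autGroup_of_normal_le_closure_genS (hb : M.Bireversible)
    {L : Subgroup M.Pi1} (hL : L.Normal)
    (hLS : L ≤ Subgroup.closure (Set.range M.genS))
    (hindex : L.relIndex (Subgroup.closure (Set.range M.genS)) ≠ 0) : Finite M.autGroup := by
  have hker : L.comap (FreeGroup.lift M.genS) ≤ (wordAction hb).ker := fun u hu =>
    Equiv.ext fun w => wordAction_eq_one_of_lift_mem hb hL hLS w u hu
  rw [← FreeGroup.range_lift_eq_closure, ← Subgroup.index_comap] at hindex
  have : (wordAction hb).ker.index ≠ 0 := fun h0 =>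
    hindex (Nat.eq_zero_of_zero_dvd (h0 ▸ Subgroup.index_dvd_of_le hker))
  rw [Subgroup.index_ker] at this
  rw [← range_wordAction hb]
  exact Nat.finite_of_card_ne_zero this

/-- The sections of `u` at words `w` only depend on the class of `w` modulo `L`, so there are
finitely many possibilities for the action of `u`. -/
theorem finite_autGroup_of_normal_le_closure_genX (hb : M.Bireversible) [Finite X]
    {L : Subgroup M.Pi1} (hL : L.Normal)
    (hLX : L ≤ Subgroup.closure (Set.range M.genX))
    (hindex : L.relIndex (Subgroup.closure (Set.range M.genX)) ≠ 0) : Finite M.autGroup := by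
  choose act sec hsec hword using exists_section hb
  let H := Subgroup.closure (Set.range M.genX)
  have hsq := isSquareGenerating hb
  let ev : List X → H := fun w => (w.map fun x => ⟨M.genX x, IsSquareGenerating.mem_closure x⟩).prod
  have hev : ∀ x w, (ev (x :: w) : M.Pi1) = M.genX x * ev w := fun x w => by simp [ev]
  have hfold : ∀ (w : List X) (u : FreeGroup S), ∃ g ∈ H, FreeGroup.lift M.genS u * ev w =
      g * FreeGroup.lift M.genS (w.foldl sec u) := by
    intro w
    induction w with
    | nil => exact fun u => ⟨1, one_mem _, by simp [ev]⟩
    | cons x w ih =>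
      intro u
      obtain ⟨g, hg, e⟩ := ih (sec u x)
      refine ⟨M.genX (act u x) * g, mul_mem (IsSquareGenerating.mem_closure _) hg, ?_⟩
      rw [hev, ← mul_assoc, hsec, mul_assoc, e, List.foldl_cons, mul_assoc]
  have hS : ∀ u, FreeGroup.lift M.genS u ∈ Subgroup.closure (Set.range M.genS) := fun u => by
    rw [← FreeGroup.range_lift_eq_closure]
    exact ⟨u, rfl⟩
  let q : List X → H ⧸ L.subgroupOf H := fun w => (ev w : H ⧸ L.subgroupOf H)
  have hq : ∀ (u : FreeGroup S) (v w : List X), q v = q w → v.foldl sec u = w.foldl sec u := by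
    intro u v w e
    obtain ⟨g₁, hg₁, e₁⟩ := hfold v u
    obtain ⟨g₂, hg₂, e₂⟩ := hfold w u
    have hl : (ev v)⁻¹ * ev w ∈ L.subgroupOf H := QuotientGroup.eq.1 e
    have hl' := hL.conj_mem _ (Subgroup.mem_subgroupOf.1 hl) (FreeGroup.lift M.genS u * ev v)
    refine (injective_lift_genS hb (hsq.eq_of_mul_inv_mem (hS _) (hS _) ?_)).symm
    have : FreeGroup.lift M.genS (w.foldl sec u) * (FreeGroup.lift M.genS (v.foldl sec u))⁻¹ =
        g₂⁻¹ * (FreeGroup.lift M.genS u * ev v * ((ev v : M.Pi1)⁻¹ * ev w) *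
          (FreeGroup.lift M.genS u * ev v)⁻¹) * g₁ := by
      rw [← inv_mul_eq_iff_eq_mul] at e₁ e₂
      rw [← e₁, ← e₂]
      group
    exact this ▸ mul_mem (mul_mem (inv_mem hg₂) (hLX hl')) hg₁
  have : Finite (H ⧸ L.subgroupOf H) := Nat.finite_of_card_ne_zero hindex
  let F : FreeGroup S → Set.range q → X → X := fun u z => act (z.2.choose.foldl sec u)
  have hF : ∀ u w, F u ⟨q w, w, rfl⟩ = act (w.foldl sec u) := fun u w =>
    congrArg act (hq u _ _ (⟨w, rfl⟩ : ∃ v, q v = q w).choose_spec)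
  have hact : ∀ (w : List X) (u v : FreeGroup S),
      (∀ w : List X, act (w.foldl sec u) = act (w.foldl sec v)) →
      wordAction hb u w = wordAction hb v w := by
    intro w
    induction w with
    | nil => intro u v _; rw [wordAction_nil, wordAction_nil]
    | cons x w ih =>
      intro u v huv
      rw [hword, hword, ih _ _ fun w' => huv (x :: w')]
      exact congrArg (· :: _) (congrFun (huv []) x)
  have hinj : Function.Injective fun σ : (wordAction hb).range => F σ.2.choose := by
    intro σ τ e
    refine Subtype.ext ?_
    rw [← σ.2.choose_spec, ← τ.2.choose_spec]
    refine Equiv.ext fun w => hact w _ _ fun w' => ?_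
    rw [← hF, ← hF]
    exact congrFun e _
  rw [← range_wordAction hb]
  exact Finite.of_injective _ hinj

end WordPerm

end Mealy

open Mealy in
/-- For a bireversible automaton with two letters or two states whose automaton group is
infinite, `π₁(Δ_A)` is not residually finite: some nontrivial element lies in every
finite-index normal subgroup. -/
theorem two_state_or_two_letter_not_residuallyFinite {S X : Type}
    [Finite S] [Finite X] [Nonempty S] [Nonempty X]
    (M : Mealy S X) (hb : M.Bireversible)
    (hcard : Nat.card X = 2 ∨ Nat.card S = 2)
    (hinf : Infinite M.autGroup) :
    ∃ γ : M.Pi1, γ ≠ 1 ∧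
      ∀ N : Subgroup M.Pi1, N.Normal → N.FiniteIndex → γ ∈ N := by
  rcases hcard with hX | hS
  · refine (isSquareGenerating hb).symm.exists_ne_one_mem_of_finiteIndex hX fun L hL hLS => ?_
    by_contra hindex
    exact not_finite_iff_infinite.2 hinf
      (finite_autGroup_of_normal_le_closure_genS hb hL hLS hindex)
  · refine (isSquareGenerating hb).exists_ne_one_mem_of_finiteIndex hS fun L hL hLX => ?_
    by_contra hindex
    exact not_finite_iff_infinite.2 hinf
      (finite_autGroup_of_normal_le_closure_genX hb hL hLX hindex)
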